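/- Let E6 = { a ∈ E8 : a_6 = a_7 = a_8 }. Every polynomial F ∈ ℂ[Y_1, …, Y_8] of total degree at most 2 that vanishes at every point of E6 lies in the ideal ⟨Nm, Y_6 − Y_7, Y_7 − Y_8⟩; moreover, there exists a polynomial of total degree 3 vanishing at every point of E6 that does not lie in ⟨Nm, Y_6 − Y_7, Y_7 − Y_8⟩. (Thus the smallest degree of a non-trivial polynomial in I(E6) is three.) -/

import Mathlib

open MvPolynomial

/-- The 240 shortest vectors of the `E₈` root lattice: the vectors `±eᵢ ± eⱼ` (`i < j`)
together with the vectors `(±1/2, …, ±1/2)` with an even number of minus signs. -/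
def E8 : Set (Fin 8 → ℝ) :=
  {v | (∃ i j : Fin 8, i < j ∧ (v i = 1 ∨ v i = -1) ∧ (v j = 1 ∨ v j = -1) ∧
          ∀ l, l ≠ i → l ≠ j → v l = 0) ∨
    ((∀ i, v i = 1 / 2 ∨ v i = -(1 / 2)) ∧
      Even (Finset.univ.filter (fun i => v i = -(1 / 2 : ℝ))).card)}

/-- A real point viewed inside `ℂ^8`. -/
def cx8 : (Fin 8 → ℝ) → (Fin 8 → ℂ) := fun v i => (v i : ℂ)

/-- `Nm = Y₁² + ⋯ + Y₈² − 2`. -/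
noncomputable def Nm8 : MvPolynomial (Fin 8) ℂ :=
  (∑ i : Fin 8, MvPolynomial.X i ^ 2) - MvPolynomial.C 2

/-- The shortest vectors of `E₆`, realized as the vectors of `E8` with equal last three
coordinates. -/
def E6 : Set (Fin 8 → ℝ) := {a ∈ E8 | a 5 = a 6 ∧ a 6 = a 7}

/-- The ideal of trivial polynomials for `E6`: the ideal generated by `Nm` and the linear
polynomials `Y₆ − Y₇` and `Y₇ − Y₈` vanishing on `E6`. -/
noncomputable def trivE6 : Ideal (MvPolynomial (Fin 8) ℂ) :=
  Ideal.span {Nm8, MvPolynomial.X 5 - MvPolynomial.X 6,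
    MvPolynomial.X 6 - MvPolynomial.X 7}

/-- A polynomial of total degree at most `2` is the sum of a constant, a linear form and a
quadratic form. -/
lemma exists_quadratic_form {σ R : Type*} [Fintype σ] [CommRing R] (p : MvPolynomial σ R)
    (hp : p.totalDegree ≤ 2) :
    ∃ (c : R) (l : σ → R) (q : σ → σ → R),
      p = C c + ∑ i, C (l i) * X i + ∑ i, ∑ j, C (q i j) * (X i * X j) := by
  classical
  rw [p.as_sum]
  refine Finset.sum_induction _ (fun p => ∃ (c : R) (l : σ → R) (q : σ → σ → R),
      p = C c + ∑ i, C (l i) * X i + ∑ i, ∑ j, C (q i j) * (X i * X j)) ?_ ?_ ?_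
  · rintro _ _ ⟨c, l, q, rfl⟩ ⟨c', l', q', rfl⟩
    refine ⟨c + c', l + l', q + q', ?_⟩
    simp only [C_add, Pi.add_apply, add_mul, Finset.sum_add_distrib]
    ring
  · exact ⟨0, 0, 0, by simp⟩
  · intro m hm
    have hdeg : m.degree ≤ 2 := (le_totalDegree hm).trans hp
    generalize p.coeff m = a
    by_cases h0 : m = 0
    · exact ⟨a, 0, 0, by simp [h0]⟩
    obtain ⟨i, hi⟩ := Finsupp.ne_iff.mp h0
    obtain ⟨m', rfl⟩ := exists_add_of_le
      (Finsupp.single_le_iff.mpr (Nat.one_le_iff_ne_zero.mpr hi))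
    by_cases h1 : m' = 0
    · refine ⟨0, Pi.single i a, 0, ?_⟩
      simp [h1, Pi.single_apply, apply_ite C, ite_mul, C_mul_X_eq_monomial]
    obtain ⟨j, hj⟩ := Finsupp.ne_iff.mp h1
    obtain ⟨m'', rfl⟩ := exists_add_of_le
      (Finsupp.single_le_iff.mpr (Nat.one_le_iff_ne_zero.mpr hj))
    have h2 : m'' = 0 := by
      rw [map_add, map_add, Finsupp.degree_single, Finsupp.degree_single] at hdeg
      exact (Finsupp.degree_eq_zero_iff _).mp (by omega)
    refine ⟨0, 0, Pi.single i (Pi.single j a), ?_⟩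
    have hij : monomial (Finsupp.single i 1 + (Finsupp.single j 1 + m'')) a =
        C a * (X i * X j) := by
      simp [h2, X, monomial_mul, C_mul_monomial]
    simp only [C_0, Pi.zero_apply, zero_mul, Finset.sum_const_zero, zero_add]
    rw [hij, Finset.sum_eq_single i, Finset.sum_eq_single j] <;>
      simp +contextual

/-- The projection `Fin 8 → Fin 6` identifying the last three indices. -/
def clampSix (i : Fin 8) : Fin 6 := ⟨min i 5, by omega⟩

/-- The points of `E6` of the form `ε eᵢ + δ eⱼ`. -/
lemma single_add_single_mem_E6 {i j : Fin 6} (hij : i < j) (hj : j < 5) {ε δ : ℝ}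
    (hε : ε = 1 ∨ ε = -1) (hδ : δ = 1 ∨ δ = -1) :
    (fun k => (Pi.single i ε + Pi.single j δ : Fin 6 → ℝ) (clampSix k)) ∈ E6 := by
  have hc : ∀ k : Fin 8, ∀ m : Fin 6, m < 5 → (clampSix k = m ↔ k = m.castLE (by decide : 6 ≤ 8)) := by
    decide
  have hi : i < 5 := hij.trans hj
  refine ⟨Or.inl ⟨i.castLE (by omega), j.castLE (by omega), hij, ?_, ?_, ?_⟩, rfl, rfl⟩
  · simpa [Pi.single_apply, hc _ _ hi, hc _ _ hj, hij.ne] using hε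
  · simpa [Pi.single_apply, hc _ _ hi, hc _ _ hj, hij.ne'] using hδ
  · intro k hki hkj
    simp [hc _ _ hi, hc _ _ hj, hki, hkj]

/-- The points of `E6` with all coordinates `±1/2`. -/
lemma half_mem_E6 {s : Fin 6 → ℤ} (hs : ∀ i, s i = 1 ∨ s i = -1)
    (heven : Even (Finset.univ.filter fun k => s (clampSix k) = -1).card) :
    (fun k => (s (clampSix k) : ℝ) / 2) ∈ E6 := by
  refine ⟨Or.inr ⟨fun k => ?_, ?_⟩, rfl, rfl⟩
  · rcases hs (clampSix k) with h | h <;> norm_num [h]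
  · convert heven using 4 with k
    rcases hs (clampSix k) with h | h <;> norm_num [h]

/-- A polynomial of degree at most two in six variables vanishing on the image of `E6` is a
multiple of the restricted norm equation. -/
lemma eq_C_mul_of_vanish (G : MvPolynomial (Fin 6) ℂ) (hdeg : G.totalDegree ≤ 2)
    (hG : ∀ y : Fin 6 → ℝ, (fun k => y (clampSix k)) ∈ E6 → eval (fun i => (y i : ℂ)) G = 0) :
    ∃ b : ℂ, G = C b *
      (X 0 ^ 2 + X 1 ^ 2 + X 2 ^ 2 + X 3 ^ 2 + X 4 ^ 2 + 3 * X 5 ^ 2 - C 2) := by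
  obtain ⟨c, l, q, rfl⟩ := exists_quadratic_form G hdeg
  have hpair : ∀ i j : Fin 6, i < j → j < 5 →
      l i = 0 ∧ l j = 0 ∧ q j i = -q i j ∧ c + q i i + q j j = 0 := by
    intro i j hij hj
    have key : ∀ ε δ : ℝ, (ε = 1 ∨ ε = -1) → (δ = 1 ∨ δ = -1) →
        c + (l i * ε + l j * δ) +
          ((q i i * (ε * ε) + q i j * (ε * δ)) + (q j i * (δ * ε) + q j j * (δ * δ))) = 0 := by
      intro ε δ hε hδ
      have h := hG _ (single_add_single_mem_E6 hij hj hε hδ)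
      have hsum : ∀ f : Fin 6 → ℂ, (∀ k, k ≠ i → k ≠ j → f k = 0) → ∑ k, f k = f i + f j := by
        intro f hf
        rw [← Finset.sum_pair hij.ne]
        refine (Finset.sum_subset (Finset.subset_univ _) fun k _ hk => ?_).symm
        simp only [Finset.mem_insert, Finset.mem_singleton, not_or] at hk
        exact hf k hk.1 hk.2
      simp only [map_add, map_sum, map_mul, eval_C, eval_X] at h
      rw [hsum, hsum, hsum, hsum] at h
      · simpa [Pi.single_apply, hij.ne, hij.ne'] using h
      all_goals
        intro k hki hkj
        simp [Pi.single_apply, hki, hkj]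
    have h1 := key 1 1 (by simp) (by simp)
    have h2 := key 1 (-1) (by simp) (by simp)
    have h3 := key (-1) 1 (by simp) (by simp)
    have h4 := key (-1) (-1) (by simp) (by simp)
    push_cast at h1 h2 h3 h4
    refine ⟨?_, ?_, ?_, ?_⟩
    · linear_combination (h1 + h2 - h3 - h4) / 4
    · linear_combination (h1 - h2 + h3 - h4) / 4
    · linear_combination (h1 - h2 - h3 + h4) / 4
    · linear_combination (h1 + h2 + h3 + h4) / 4
  obtain ⟨l0, l1, q01, d01⟩ := hpair 0 1 (by decide) (by decide)
  obtain ⟨-, l2, q02, d02⟩ := hpair 0 2 (by decide) (by decide)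
  obtain ⟨-, l3, q03, d03⟩ := hpair 0 3 (by decide) (by decide)
  obtain ⟨-, l4, q04, d04⟩ := hpair 0 4 (by decide) (by decide)
  obtain ⟨-, -, q12, d12⟩ := hpair 1 2 (by decide) (by decide)
  obtain ⟨-, -, q13, -⟩ := hpair 1 3 (by decide) (by decide)
  obtain ⟨-, -, q14, -⟩ := hpair 1 4 (by decide) (by decide)
  obtain ⟨-, -, q23, -⟩ := hpair 2 3 (by decide) (by decide)
  obtain ⟨-, -, q24, -⟩ := hpair 2 4 (by decide) (by decide)
  obtain ⟨-, -, q34, -⟩ := hpair 3 4 (by decide) (by decide)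
  have d0 : q 0 0 = -c / 2 := by linear_combination (d01 + d02 - d12) / 2
  have d1 : q 1 1 = -c / 2 := by linear_combination d01 - d0
  have d2 : q 2 2 = -c / 2 := by linear_combination d02 - d0
  have d3 : q 3 3 = -c / 2 := by linear_combination d03 - d0
  have d4 : q 4 4 = -c / 2 := by linear_combination d04 - d0
  have hhalf : ∀ s : Fin 6 → ℤ, (∀ i, s i = 1 ∨ s i = -1) →
      Even (Finset.univ.filter fun k => s (clampSix k) = -1).card →
      c + ∑ i, l i * (s i / 2) + ∑ i, ∑ j, q i j * ((s i / 2) * (s j / 2)) = 0 := by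
    intro s hs heven
    simpa using hG (fun i => (s i : ℝ) / 2) (half_mem_E6 hs heven)
  have hp := hhalf ![1, 1, 1, 1, 1, 1] (by decide) (by decide)
  have hn := hhalf ![-1, -1, -1, -1, -1, -1] (by decide) (by decide)
  have h01 := hhalf ![-1, -1, 1, 1, 1, 1] (by decide) (by decide)
  have h02 := hhalf ![-1, 1, -1, 1, 1, 1] (by decide) (by decide)
  have h12 := hhalf ![1, -1, -1, 1, 1, 1] (by decide) (by decide)
  have h03 := hhalf ![-1, 1, 1, -1, 1, 1] (by decide) (by decide)
  have h04 := hhalf ![-1, 1, 1, 1, -1, 1] (by decide) (by decide)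
  simp [Fin.sum_univ_six, l0, l1, l2, l3, l4, q01, q02, q03, q04, q12, q13, q14, q23, q24, q34,
    d0, d1, d2, d3, d4] at hp hn h01 h02 h12 h03 h04
  have l5 : l 5 = 0 := by linear_combination hp - hn
  have r0 : q 5 0 = -q 0 5 := by linear_combination hp * 2 - h01 - h02 + h12 - hp
  have r1 : q 5 1 = -q 1 5 := by linear_combination (hp - h01) * 2 - r0
  have r2 : q 5 2 = -q 2 5 := by linear_combination (hp - h02) * 2 - r0
  have r3 : q 5 3 = -q 3 5 := by linear_combination (hp - h03) * 2 - r0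
  have r4 : q 5 4 = -q 4 5 := by linear_combination (hp - h04) * 2 - r0
  have d5 : q 5 5 = 3 * (-c / 2) := by
    linear_combination (hp + hn) * 2 - r0 - r1 - r2 - r3 - r4
  refine ⟨-c / 2, ?_⟩
  have hc : (C c : MvPolynomial (Fin 6) ℂ) = C (-c / 2) * (-C 2) := by
    rw [← C_neg, ← C_mul]
    congr 1
    ring
  have h3 : (C 3 : MvPolynomial (Fin 6) ℂ) = 3 := map_ofNat C 3
  simp only [Fin.sum_univ_six, l0, l1, l2, l3, l4, l5, q01, q02, q03, q04, q12, q13, q14, q23,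
    q24, q34, d0, d1, d2, d3, d4, d5, r0, r1, r2, r3, r4, C_mul, C_neg, C_0, h3]
  linear_combination hc

lemma mem_trivE6_of_totalDegree_le_two (F : MvPolynomial (Fin 8) ℂ) (hdeg : F.totalDegree ≤ 2)
    (hF : ∀ a ∈ E6, eval (cx8 a) F = 0) : F ∈ trivE6 := by
  obtain ⟨b, hb⟩ := eq_C_mul_of_vanish (rename clampSix F)
    ((totalDegree_rename_le _ _).trans hdeg) fun y hy => by
      rw [eval_rename]
      exact hF _ hy
  have hNm : Ideal.Quotient.mk trivE6 Nm8 = 0 :=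
    Ideal.Quotient.eq_zero_iff_mem.mpr (Ideal.subset_span (by simp))
  have h56 : Ideal.Quotient.mk trivE6 (X 5) = Ideal.Quotient.mk trivE6 (X 6) :=
    Ideal.Quotient.eq.mpr (Ideal.subset_span (by simp))
  have h67 : Ideal.Quotient.mk trivE6 (X 6) = Ideal.Quotient.mk trivE6 (X 7) :=
    Ideal.Quotient.eq.mpr (Ideal.subset_span (by simp))
  let g : Fin 6 → MvPolynomial (Fin 8) ℂ ⧸ trivE6 :=
    fun i => Ideal.Quotient.mk trivE6 (X (i.castLE (by omega)))
  have hg : Ideal.Quotient.mkₐ ℂ trivE6 = aeval (g ∘ clampSix) := by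
    refine algHom_ext fun k => ?_
    rw [aeval_X]
    fin_cases k
    iterate 6 rfl
    · exact h56.symm
    · exact (h56.trans h67).symm
  rw [← Ideal.Quotient.eq_zero_iff_mem, ← Ideal.Quotient.mkₐ_eq_mk ℂ, hg, ← aeval_rename, hb]
  rw [Nm8, Fin.sum_univ_eight] at hNm
  simp only [map_add, map_sub, map_pow, ← h67, ← h56] at hNm
  change g 0 ^ 2 + g 1 ^ 2 + g 2 ^ 2 + g 3 ^ 2 + g 4 ^ 2 + g 5 ^ 2 + g 5 ^ 2 + g 5 ^ 2 -
    Ideal.Quotient.mk trivE6 (C 2) = 0 at hNm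
  rw [map_mul]
  convert mul_zero _
  rw [← hNm]
  simp only [map_add, map_sub, map_mul, map_pow, aeval_X, map_ofNat]
  ring

lemma eval_eq_zero_of_mem_trivE6 {F : MvPolynomial (Fin 8) ℂ} (hF : F ∈ trivE6) {x : Fin 8 → ℂ}
    (hx : ∑ i, x i ^ 2 = 2) (h56 : x 5 = x 6) (h67 : x 6 = x 7) : eval x F = 0 := by
  have hle : trivE6 ≤ RingHom.ker (eval x) := by
    rw [trivE6, Ideal.span_le]
    rintro _ (rfl | rfl | rfl) <;> simp [RingHom.mem_ker, Nm8, hx, h56, h67]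
  exact hle hF

/-- On `E6` one has `y₁ y₂ y₃ = y₄ y₅ y₆`. -/
lemma mul_eq_mul_of_mem_E6 {a : Fin 8 → ℝ} (ha : a ∈ E6) :
    a 0 * a 1 * a 2 = a 3 * a 4 * a 5 := by
  obtain ⟨⟨i, j, hij, -, -, h⟩ | ⟨hh, heven⟩, h56, h67⟩ := ha
  · have hex : ∀ i j : Fin 8, (∃ k : Fin 8, k < 3 ∧ k ≠ i ∧ k ≠ j) ∧
        ∃ k : Fin 8, 3 ≤ k ∧ k < 6 ∧ k ≠ i ∧ k ≠ j := by decide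
    obtain ⟨⟨k, hk, hki, hkj⟩, m, hm, hm', hmi, hmj⟩ := hex i j
    have hk0 := h k hki hkj
    have hm0 := h m hmi hmj
    have hl : a 0 * a 1 * a 2 = 0 := by
      fin_cases k <;> simp_all
    have hr : a 3 * a 4 * a 5 = 0 := by
      fin_cases m <;> simp_all
    rw [hl, hr]
  · have hsq : ∀ i, a i ^ 2 = 1 / 4 := fun i => by
      rcases hh i with h | h <;> rw [h] <;> norm_num
    have hprod : ∏ i, a i = (1 / 2) ^ 8 := by
      have hi : ∀ i, a i = (if a i = -(1 / 2) then -1 else 1) * (1 / 2) := fun i => by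
        rcases hh i with h | h <;> rw [h] <;> norm_num
      rw [Finset.prod_congr rfl fun i _ => hi i, Finset.prod_mul_distrib, Finset.prod_ite]
      simp only [Finset.prod_const, heven.neg_one_pow, one_mul, one_pow]
      simp
    rw [Fin.prod_univ_eight, ← h67, ← h56] at hprod
    have hmul : (a 0 * a 1 * a 2) * (a 3 * a 4 * a 5) = 1 / 64 := by
      linear_combination 4 * hprod - 4 * (a 0 * a 1 * a 2) * (a 3 * a 4 * a 5) * hsq 5
    have hl : (a 0 * a 1 * a 2) ^ 2 = 1 / 64 := by
      rw [mul_pow, mul_pow, hsq, hsq, hsq]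
      norm_num
    have hr : (a 3 * a 4 * a 5) ^ 2 = 1 / 64 := by
      rw [mul_pow, mul_pow, hsq, hsq, hsq]
      norm_num
    rw [← sub_eq_zero, ← sq_eq_zero_iff]
    linear_combination hl + hr - 2 * hmul

lemma totalDegree_X_mul_X_mul_X {σ R : Type*} [CommSemiring R] [Nontrivial R] (i j k : σ) :
    (X i * X j * X k : MvPolynomial σ R).totalDegree = 3 := by
  simp only [X, monomial_mul, mul_one]
  rw [totalDegree_monomial _ one_ne_zero]
  change Finsupp.degree _ = 3
  simp

lemma totalDegree_cubic :
    (X 0 * X 1 * X 2 - X 3 * X 4 * X 5 : MvPolynomial (Fin 8) ℂ).totalDegree = 3 := by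
  refine le_antisymm ((totalDegree_sub _ _).trans (by simp [totalDegree_X_mul_X_mul_X])) ?_
  have hmem : (Finsupp.single 0 1 + Finsupp.single 1 1 + Finsupp.single 2 1 : Fin 8 →₀ ℕ) ∈
      (X 0 * X 1 * X 2 - X 3 * X 4 * X 5 : MvPolynomial (Fin 8) ℂ).support := by
    have hne : (Finsupp.single 3 1 + Finsupp.single 4 1 + Finsupp.single 5 1 : Fin 8 →₀ ℕ) ≠
        Finsupp.single 0 1 + Finsupp.single 1 1 + Finsupp.single 2 1 := fun h => by
      simpa using DFunLike.congr_fun h 0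
    simp only [mem_support_iff, coeff_sub, X, monomial_mul, mul_one, coeff_monomial, hne]
    simp
  have h : Finsupp.degree _ ≤ _ := le_totalDegree hmem
  simpa using h

/-- Every `F ∈ ℂ[Y₁,…,Y₈]` of total degree at most `2` vanishing on `E6`
lies in `⟨Nm, Y₆ − Y₇, Y₇ − Y₈⟩`, and some polynomial of total degree `3` vanishing on
`E6` does not lie in `⟨Nm, Y₆ − Y₇, Y₇ − Y₈⟩`. -/
theorem statement15 :
    (∀ F : MvPolynomial (Fin 8) ℂ, F.totalDegree ≤ 2 →
      (∀ a ∈ E6, MvPolynomial.eval (cx8 a) F = 0) → F ∈ trivE6) ∧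
    ∃ F : MvPolynomial (Fin 8) ℂ, F.totalDegree = 3 ∧
      (∀ a ∈ E6, MvPolynomial.eval (cx8 a) F = 0) ∧ F ∉ trivE6 := by
  refine ⟨mem_trivE6_of_totalDegree_le_two, X 0 * X 1 * X 2 - X 3 * X 4 * X 5,
    totalDegree_cubic, fun a ha => ?_, fun hmem => ?_⟩
  · simp only [map_sub, map_mul, eval_X, cx8, sub_eq_zero]
    exact_mod_cast mul_eq_mul_of_mem_E6 ha
  · have h := eval_eq_zero_of_mem_trivE6 hmem (x := ![1, 1, 1, Complex.I, 0, 0, 0, 0])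
      (by simp [Fin.sum_univ_eight]; norm_num) rfl rfl
    simp at h
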